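/- Let $K$ be any field and $n\geq 4$. Then for all $g,h\in U=K[y_1,\ldots,y_n]$, the endomorphism $A(h,g)=(x_1+[x_1,x_n]hg+[x_2,x_n]hg^2,\ x_2-[x_1,x_n]h-[x_2,x_n]hg,\ x_3,\ldots,x_n)$ of $M_n$ is an automorphism and is almost tame. -/

import Mathlib

noncomputable section

/-- The free metabelian Lie algebra of rank `n` over `K`: the quotient of the free Lie
algebra on `n` generators by its second derived ideal. -/
abbrev FreeMetabelianLie (K : Type) [Field K] (n : ℕ) : Type :=
  FreeLieAlgebra K (Fin n) ⧸ LieAlgebra.derivedSeries K (FreeLieAlgebra K (Fin n)) 2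

/-- The free generators `x₁, …, xₙ` of the free metabelian Lie algebra. -/
def xg (K : Type) [Field K] (n : ℕ) (i : Fin n) : FreeMetabelianLie K n :=
  LieSubmodule.Quotient.mk (N := LieAlgebra.derivedSeries K (FreeLieAlgebra K (Fin n)) 2)
    (FreeLieAlgebra.of K i)

/-- The group structure on Lie algebra automorphisms, with `(e * f) x = e (f x)`. -/
instance lieAutGroup (K : Type) [CommRing K] (L : Type) [LieRing L] [LieAlgebra K L] :
    Group (L ≃ₗ⁅K⁆ L) where
  mul e f := f.trans e
  one := LieEquiv.refl
  inv := LieEquiv.symm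
  mul_assoc _ _ _ := LieEquiv.ext fun _ => rfl
  one_mul _ := LieEquiv.ext fun _ => rfl
  mul_one _ := LieEquiv.ext fun _ => rfl
  inv_mul_cancel e := LieEquiv.ext fun x => e.symm_apply_apply x

/-- An automorphism of the free metabelian Lie algebra is elementary if it maps some `xᵢ` to
`α • xᵢ + f`, with `0 ≠ α ∈ K` and `f` in the subalgebra generated by the other generators,
and fixes all other generators. -/
def IsElementaryAut (K : Type) [Field K] (n : ℕ)
    (φ : FreeMetabelianLie K n ≃ₗ⁅K⁆ FreeMetabelianLie K n) : Prop :=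
  ∃ (i : Fin n) (α : K) (f : FreeMetabelianLie K n), α ≠ 0 ∧
    f ∈ LieSubalgebra.lieSpan K (FreeMetabelianLie K n) (xg K n '' {j | j ≠ i}) ∧
    φ (xg K n i) = α • xg K n i + f ∧ ∀ j : Fin n, j ≠ i → φ (xg K n j) = xg K n j

/-- A tame automorphism is one in the subgroup generated by the elementary automorphisms. -/
def IsTame (K : Type) [Field K] (n : ℕ)
    (φ : FreeMetabelianLie K n ≃ₗ⁅K⁆ FreeMetabelianLie K n) : Prop :=
  φ ∈ Subgroup.closure {ψ | IsElementaryAut K n ψ}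

/-- A Chein automorphism (one-row transformation) moves only one generator. -/
def IsCheinAut (K : Type) [Field K] (n : ℕ)
    (φ : FreeMetabelianLie K n ≃ₗ⁅K⁆ FreeMetabelianLie K n) : Prop :=
  ∃ i : Fin n, ∀ j : Fin n, j ≠ i → φ (xg K n j) = xg K n j

/-- An almost tame automorphism is one in the subgroup generated by Chein automorphisms. -/
def IsAlmostTame (K : Type) [Field K] (n : ℕ)
    (φ : FreeMetabelianLie K n ≃ₗ⁅K⁆ FreeMetabelianLie K n) : Prop :=
  φ ∈ Subgroup.closure {ψ | IsCheinAut K n ψ}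

/-- `monoSet K n k` is the set of right-normed Lie monomials of degree `k+1` in the
generators. -/
def monoSet (K : Type) [Field K] (n : ℕ) : ℕ → Set (FreeMetabelianLie K n)
  | 0 => Set.range (xg K n)
  | k + 1 => {z | ∃ u ∈ monoSet K n k, ∃ i : Fin n, z = ⁅u, xg K n i⁆}

/-- `gradePiece K n k` (for `k ≥ 1`) is the homogeneous component `L_k` of the standard
grading: the linear span of the Lie monomials of degree `k` in the generators. -/
def gradePiece (K : Type) [Field K] (n : ℕ) (k : ℕ) : Submodule K (FreeMetabelianLie K n) :=
  Submodule.span K (monoSet K n (k - 1))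

/-- The automorphism `φ = (l₁ + m₁, …, lₙ + mₙ)` (with `lᵢ` linear, `mᵢ ∈ [M,M]`) has lower
degree `≥ d`: each `φ(xᵢ)` lies in `L₁ ⊕ (⨆ k ≥ d, L_k)`. -/
def AutLdegGE (K : Type) [Field K] (n : ℕ)
    (φ : FreeMetabelianLie K n ≃ₗ⁅K⁆ FreeMetabelianLie K n) (d : ℕ) : Prop :=
  ∀ i : Fin n, φ (xg K n i) ∈
    gradePiece K n 1 ⊔ ⨆ (k : ℕ) (_ : d ≤ k), gradePiece K n k

/-- The action of a polynomial `a ∈ U = K[y₁,…,yₙ]` on `m`; for `m ∈ [M,M]` this is the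
canonical `U`-module action on the derived ideal, determined by `m ⬝ yᵢ = ⁅m, xᵢ⁆`. -/
def polyAct (K : Type) [Field K] (n : ℕ) (a : MvPolynomial (Fin n) K)
    (m : FreeMetabelianLie K n) : FreeMetabelianLie K n :=
  ∑ d ∈ a.support, a.coeff d •
    ((List.ofFn fun i : Fin n =>
      (-(LieAlgebra.ad K (FreeMetabelianLie K n) (xg K n i))) ^ (d i)).prod m)

/-- The polynomial `a` has lower degree `≥ d`: every monomial of `a` has total degree `≥ d`. -/
def PolyLdegGE (K : Type) [Field K] (n : ℕ) (a : MvPolynomial (Fin n) K) (d : ℕ) : Prop :=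
  ∀ v ∈ a.support, d ≤ ∑ i, v i

/-- An exponential automorphism: `exp (ad z) = id + ad z` for some `z ∈ [M,M]`. -/
def IsExponentialAut (K : Type) [Field K] (n : ℕ)
    (φ : FreeMetabelianLie K n ≃ₗ⁅K⁆ FreeMetabelianLie K n) : Prop :=
  ∃ z ∈ LieAlgebra.derivedSeries K (FreeMetabelianLie K n) 1,
    ∀ m : FreeMetabelianLie K n, φ m = m + ⁅z, m⁆

end

noncomputable section

namespace FreeMetabelianLie

open MvPolynomial

variable {K : Type} [Field K] {n : ℕ}

variable (K n) in
/-- The projection of the free Lie algebra onto the free metabelian Lie algebra. -/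
def proj : FreeLieAlgebra K (Fin n) →ₗ⁅K⁆ FreeMetabelianLie K n :=
  { (LieSubmodule.Quotient.mk' (LieAlgebra.derivedSeries K (FreeLieAlgebra K (Fin n)) 2) :
      FreeLieAlgebra K (Fin n) →ₗ[K] FreeMetabelianLie K n) with
    map_lie' := fun {x y} => LieSubmodule.Quotient.mk_bracket
      (I := LieAlgebra.derivedSeries K (FreeLieAlgebra K (Fin n)) 2) x y }

theorem proj_surjective : Function.Surjective (proj K n) :=
  LieSubmodule.Quotient.surjective_mk' _

/-- The free metabelian Lie algebra is metabelian. -/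
theorem derivedSeries_two_eq_bot :
    LieAlgebra.derivedSeries K (FreeMetabelianLie K n) 2 = ⊥ := by
  rw [← LieIdeal.derivedSeries_map_eq 2 proj_surjective, LieIdeal.map_eq_bot_iff]
  intro x hx
  exact (LieSubmodule.Quotient.mk_eq_zero _).mpr hx

/-- Endomorphisms are determined by the images of the free generators. -/
theorem hom_ext {f g : FreeMetabelianLie K n →ₗ⁅K⁆ FreeMetabelianLie K n}
    (h : ∀ i, f (xg K n i) = g (xg K n i)) : f = g := by
  have hfg : f.comp (proj K n) = g.comp (proj K n) := FreeLieAlgebra.hom_ext h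
  ext z
  obtain ⟨a, rfl⟩ := proj_surjective z
  exact LieHom.congr_fun hfg a

theorem exists_lift (f : Fin n → FreeMetabelianLie K n) :
    ∃ φ : FreeMetabelianLie K n →ₗ⁅K⁆ FreeMetabelianLie K n, ∀ i, φ (xg K n i) = f i := by
  let F := FreeLieAlgebra.lift K f
  have hF : ∀ a ∈ (LieAlgebra.derivedSeries K (FreeLieAlgebra K (Fin n)) 2).toSubmodule,
      F a = 0 := fun a ha => by
    have h := LieIdeal.derivedSeries_map_le (f := F) 2 (LieIdeal.mem_map ha)
    rwa [derivedSeries_two_eq_bot, LieSubmodule.mem_bot] at h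
  refine ⟨{ (LieAlgebra.derivedSeries K (FreeLieAlgebra K (Fin n)) 2).toSubmodule.liftQ
      (F : FreeLieAlgebra K (Fin n) →ₗ[K] FreeMetabelianLie K n) hF with
    map_lie' := fun {x y} => ?_ }, fun i => FreeLieAlgebra.lift_of_apply f i⟩
  induction x using Quotient.inductionOn'
  induction y using Quotient.inductionOn'
  exact F.map_lie _ _

/-- The endomorphism of the free metabelian Lie algebra with given images of generators. -/
def lift (f : Fin n → FreeMetabelianLie K n) :
    FreeMetabelianLie K n →ₗ⁅K⁆ FreeMetabelianLie K n :=
  (exists_lift f).choose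

theorem lift_xg (f : Fin n → FreeMetabelianLie K n) (i : Fin n) : lift f (xg K n i) = f i :=
  (exists_lift f).choose_spec i

variable (K n) in
/-- The derived ideal of the free metabelian Lie algebra. -/
abbrev Derived : Type := LieAlgebra.derivedSeries K (FreeMetabelianLie K n) 1

theorem lie_mem_derived (a b : FreeMetabelianLie K n) :
    ⁅a, b⁆ ∈ LieAlgebra.derivedSeries K (FreeMetabelianLie K n) 1 :=
  LieSubmodule.lie_mem_lie (LieSubmodule.mem_top a) (LieSubmodule.mem_top b)

theorem lie_eq_zero (a b : Derived K n) :
    ⁅(a : FreeMetabelianLie K n), (b : FreeMetabelianLie K n)⁆ = 0 := by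
  have h : ⁅(a : FreeMetabelianLie K n), (b : FreeMetabelianLie K n)⁆ ∈
      LieAlgebra.derivedSeries K (FreeMetabelianLie K n) 2 :=
    LieSubmodule.lie_mem_lie a.2 b.2
  rwa [derivedSeries_two_eq_bot, LieSubmodule.mem_bot] at h

/-- Right bracketing with the `i`-th generator on the derived ideal. -/
def rightLie (i : Fin n) : Module.End K (Derived K n) :=
  -(LieModule.toEnd K (FreeMetabelianLie K n) (Derived K n) (xg K n i))

theorem coe_rightLie (i : Fin n) (d : Derived K n) :
    (rightLie i d : FreeMetabelianLie K n) = ⁅(d : FreeMetabelianLie K n), xg K n i⁆ := by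
  simp [rightLie]

theorem rightLie_comm (i j : Fin n) :
    rightLie (K := K) i * rightLie j = rightLie j * rightLie i := by
  ext d
  have h := leibniz_lie (d : FreeMetabelianLie K n) (xg K n j) (xg K n i)
  have h0 := lie_eq_zero d ⟨_, lie_mem_derived (xg K n j) (xg K n i)⟩
  simp only [Module.End.mul_apply, coe_rightLie]
  rw [h0] at h
  rw [← lie_skew (xg K n j)] at h
  rw [← sub_eq_zero, sub_eq_add_neg, ← h]

open scoped IsMulCommutative in
theorem exists_act : ∃ act : MvPolynomial (Fin n) K →ₐ[K] Module.End K (Derived K n),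
    ∀ i, act (X i) = rightLie i := by
  let S := Algebra.adjoin K (Set.range (rightLie (K := K) (n := n)))
  have : IsMulCommutative S := Algebra.isMulCommutative_adjoin K (by
    rintro _ ⟨i, rfl⟩ _ ⟨j, rfl⟩
    exact rightLie_comm i j)
  refine ⟨S.val.comp (aeval fun i => (⟨rightLie i,
    Algebra.subset_adjoin ⟨i, rfl⟩⟩ : S)), fun i => ?_⟩
  rw [AlgHom.comp_apply, aeval_X]
  rfl

/-- The polynomial action on the derived ideal, with `X i` acting by right bracketing with the
`i`-th generator. -/
def act : MvPolynomial (Fin n) K →ₐ[K] Module.End K (Derived K n) :=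
  exists_act.choose

theorem act_X (i : Fin n) : act (K := K) (X i) = rightLie i :=
  exists_act.choose_spec i

instance derivedModule : Module (MvPolynomial (Fin n) K) (Derived K n) :=
  Module.compHom _ (act (K := K) (n := n)).toRingHom

theorem smul_def (p : MvPolynomial (Fin n) K) (d : Derived K n) : p • d = act p d := rfl

instance derivedScalarTower :
    IsScalarTower K (MvPolynomial (Fin n) K) (Derived K n) :=
  ⟨fun a p d => by rw [smul_def, smul_def, map_smul, LinearMap.smul_apply]⟩

theorem coe_X_smul (i : Fin n) (d : Derived K n) :
    ((X i : MvPolynomial (Fin n) K) • d : Derived K n) =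
      ⁅(d : FreeMetabelianLie K n), xg K n i⁆ := by
  rw [smul_def, act_X, coe_rightLie]

theorem coe_monomial_smul (v : Fin n →₀ ℕ) (a : K) (d : Derived K n) :
    ((monomial v a : MvPolynomial (Fin n) K) • d : Derived K n) =
      a • (List.ofFn fun i : Fin n =>
        (-(LieAlgebra.ad K (FreeMetabelianLie K n) (xg K n i))) ^ (v i)).prod
          (d : FreeMetabelianLie K n) := by
  have key : ∀ (l : List (Fin n)) (d : Derived K n),
      (((l.map fun i => act (K := K) (X i) ^ v i).prod d : Derived K n) :
        FreeMetabelianLie K n) =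
      (l.map fun i : Fin n =>
        (-(LieAlgebra.ad K (FreeMetabelianLie K n) (xg K n i))) ^ (v i)).prod
          (d : FreeMetabelianLie K n) := by
    intro l
    induction l with
    | nil => intro d; rfl
    | cons i l ih =>
      intro d
      simp only [List.map_cons, List.prod_cons, Module.End.mul_apply]
      rw [← ih]
      generalize (l.map fun i => act (K := K) (X i) ^ v i).prod d = e
      induction v i with
      | zero => rfl
      | succ k ihk =>
        rw [pow_succ', pow_succ', Module.End.mul_apply, Module.End.mul_apply, ← ihk, act_X,
          coe_rightLie]
        simp
  rw [List.ofFn_eq_map, ← key, ← LieSubmodule.coe_smul, smul_def]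
  congr 2
  rw [monomial_eq, Finsupp.prod_fintype _ _ (fun _ => pow_zero _), map_mul,
    ← Fin.prod_ofFn, map_list_prod, List.ofFn_eq_map, List.map_map, C_eq_smul_one, map_smul, map_one]
  simp [Function.comp_def]

theorem polyAct_coe (p : MvPolynomial (Fin n) K) (d : Derived K n) :
    polyAct K n p d = ((p • d : Derived K n) : FreeMetabelianLie K n) := by
  conv_rhs => rw [p.as_sum, Finset.sum_smul]
  refine Eq.trans (Finset.sum_congr rfl fun v _ => (coe_monomial_smul v _ d).symm) ?_
  exact (map_sum (LieSubmodule.incl (LieAlgebra.derivedSeries K (FreeMetabelianLie K n) 1)) _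
    _).symm

variable (K) in
/-- The bracket of two generators, as an element of the derived ideal. -/
def brk (i j : Fin n) : Derived K n := ⟨⁅xg K n i, xg K n j⁆, lie_mem_derived _ _⟩

theorem jacobi (i j k : Fin n) :
    (X k : MvPolynomial (Fin n) K) • brk K i j + (X i : MvPolynomial (Fin n) K) • brk K j k +
      (X j : MvPolynomial (Fin n) K) • brk K k i = 0 := by
  apply Subtype.ext
  have h := lie_jacobi (xg K n k) (xg K n i) (xg K n j)
  rw [← lie_skew _ ⁅xg K n i, xg K n j⁆, ← lie_skew _ ⁅xg K n j, xg K n k⁆,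
    ← lie_skew _ ⁅xg K n k, xg K n i⁆, ← neg_add, ← neg_add, neg_eq_zero] at h
  simpa [coe_X_smul, brk] using h

theorem neg_brk (i j : Fin n) : -brk K i j = brk K j i := Subtype.ext (lie_skew _ _)

/-- The endomorphism `xᵢ ↦ xᵢ + μᵢ`, for `μᵢ` in the derived ideal. -/
def ia (μ : Fin n → Derived K n) : FreeMetabelianLie K n →ₗ⁅K⁆ FreeMetabelianLie K n :=
  lift fun i => xg K n i + μ i

theorem ia_xg (μ : Fin n → Derived K n) (i : Fin n) : ia μ (xg K n i) = xg K n i + μ i :=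
  lift_xg _ i

/-- The restriction of `ia μ` to the derived ideal is linear over the polynomial ring. -/
def iaDerived (μ : Fin n → Derived K n) :
    Derived K n →ₗ[MvPolynomial (Fin n) K] Derived K n where
  toFun d := ⟨ia μ d, LieIdeal.derivedSeries_map_le 1 (LieIdeal.mem_map d.2)⟩
  map_add' a b := Subtype.ext (map_add (ia μ) _ _)
  map_smul' p d := by
    dsimp only [RingHom.id_apply]
    induction p using MvPolynomial.induction_on generalizing d with
    | C a =>
      rw [← algebraMap_eq, algebraMap_smul, algebraMap_smul]
      exact Subtype.ext (map_smul (ia μ) a _)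
    | add p q hp hq =>
      rw [add_smul, add_smul, ← hp, ← hq]
      exact Subtype.ext (map_add (ia μ) _ _)
    | mul_X p i hp =>
      rw [mul_smul, mul_smul, hp]
      congr 1
      apply Subtype.ext
      simp only [coe_X_smul, LieHom.map_lie, ia_xg, lie_add, add_eq_left]
      exact lie_eq_zero ⟨ia μ d, LieIdeal.derivedSeries_map_le 1 (LieIdeal.mem_map d.2)⟩ _

theorem coe_iaDerived (μ : Fin n → Derived K n) (d : Derived K n) :
    (iaDerived μ d : FreeMetabelianLie K n) = ia μ d := rfl

theorem iaDerived_brk (μ : Fin n → Derived K n) (i j : Fin n) :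
    iaDerived μ (brk K i j) = brk K i j + (X j : MvPolynomial (Fin n) K) • μ i -
      (X i : MvPolynomial (Fin n) K) • μ j := by
  apply Subtype.ext
  have h := lie_eq_zero (μ i) (μ j)
  simp only [coe_iaDerived, brk, LieHom.map_lie, ia_xg, LieSubmodule.coe_sub,
    LieSubmodule.coe_add, coe_X_smul, add_lie, lie_add, h]
  rw [← lie_skew (xg K n i) (μ j : FreeMetabelianLie K n)]
  abel

theorem ia_comp (μ ν : Fin n → Derived K n) (z : FreeMetabelianLie K n) :
    ia μ (ia ν z) = ia (fun i => μ i + iaDerived μ (ν i)) z := by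
  have h : (ia μ).comp (ia ν) = ia (fun i => μ i + iaDerived μ (ν i)) := hom_ext fun i => by
    simp [ia_xg, coe_iaDerived, add_assoc]
  exact LieHom.congr_fun h z

theorem ia_zero (z : FreeMetabelianLie K n) : ia (0 : Fin n → Derived K n) z = z := by
  have h : ia (0 : Fin n → Derived K n) = LieHom.id := hom_ext fun i => by simp [ia_xg]
  exact LieHom.congr_fun h z

/-- An equivalence from a pair of mutually inverse homomorphisms. -/
def equivOfInverse (f g : FreeMetabelianLie K n →ₗ⁅K⁆ FreeMetabelianLie K n)
    (hgf : ∀ z, g (f z) = z) (hfg : ∀ z, f (g z) = z) :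
    FreeMetabelianLie K n ≃ₗ⁅K⁆ FreeMetabelianLie K n :=
  { f with
    invFun := g
    left_inv := hgf
    right_inv := hfg }

theorem exists_equiv_ia {μ : Fin n → Derived K n} (h : ∀ i, iaDerived μ (μ i) = μ i)
    (h' : ∀ i, iaDerived (-μ) (μ i) = μ i) :
    ∃ e : FreeMetabelianLie K n ≃ₗ⁅K⁆ FreeMetabelianLie K n, ∀ z, e z = ia μ z := by
  refine ⟨equivOfInverse (ia μ) (ia (-μ)) (fun z => ?_) (fun z => ?_), fun _ => rfl⟩
  · rw [ia_comp, show (fun i => (-μ) i + iaDerived (-μ) (μ i)) = 0 by ext; simp [h'], ia_zero]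
  · rw [ia_comp, show (fun i => μ i + iaDerived μ ((-μ) i)) = 0 by ext; simp [h], ia_zero]

/-- The endomorphism `xᵢ ↦ xᵢ + μᵢ` is an almost tame automorphism. -/
def AlmostTameIA (μ : Fin n → Derived K n) : Prop :=
  ∃ e : FreeMetabelianLie K n ≃ₗ⁅K⁆ FreeMetabelianLie K n,
    IsAlmostTame K n e ∧ ∀ z, e z = ia μ z

theorem AlmostTameIA.add {μ ν : Fin n → Derived K n} (hμ : AlmostTameIA μ)
    (hν : AlmostTameIA ν) (h : ∀ i, iaDerived μ (ν i) = ν i) : AlmostTameIA (μ + ν) := by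
  obtain ⟨e, he, heμ⟩ := hμ
  obtain ⟨f, hf, hfν⟩ := hν
  refine ⟨e * f, Subgroup.mul_mem _ he hf, fun z => ?_⟩
  change e (f z) = _
  rw [hfν, heμ, ia_comp]
  simp only [h]
  rfl

theorem AlmostTameIA.conj {μ ν ρ : Fin n → Derived K n} (hμ : AlmostTameIA μ)
    (hν : AlmostTameIA ν)
    (h : ∀ i, μ i + iaDerived μ (ν i) = ρ i + iaDerived ρ (μ i)) : AlmostTameIA ρ := by
  obtain ⟨e, he, heμ⟩ := hμ
  obtain ⟨f, hf, hfν⟩ := hν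
  refine ⟨e * f * e⁻¹, Subgroup.mul_mem _ (Subgroup.mul_mem _ he hf) (Subgroup.inv_mem _ he),
    fun z => ?_⟩
  change e (f (e.symm z)) = _
  rw [hfν, heμ, ia_comp, funext h, ← ia_comp, ← heμ, e.apply_symm_apply]

theorem almostTameIA_single {i j k : Fin n} (hj : j ≠ i) (hk : k ≠ i)
    (u : MvPolynomial (Fin n) K) : AlmostTameIA (Pi.single i (u • brk K j k)) := by
  have hfix : ∀ d : Derived K n, iaDerived (Pi.single i d) (brk K j k) = brk K j k := by
    intro d
    simp [iaDerived_brk, hj, hk]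
  have hfix' : ∀ d l, iaDerived (Pi.single i d)
      ((Pi.single i (u • brk K j k) : Fin n → Derived K n) l) =
        (Pi.single i (u • brk K j k) : Fin n → Derived K n) l := by
    intro d l
    by_cases hl : l = i
    · subst hl
      simp [hfix]
    · simp [hl]
  obtain ⟨e, he⟩ := exists_equiv_ia (hfix' _) (by
    intro l
    rw [← Pi.single_neg]
    exact hfix' _ l)
  refine ⟨e, Subgroup.subset_closure ⟨i, fun l hl => ?_⟩, he⟩
  simp [he, ia_xg, hl]

/-- The family with `i`-th entry `a • m`, `j`-th entry `b • m`, and zero elsewhere. -/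
def pairVec (i j : Fin n) (a b : MvPolynomial (Fin n) K) (m : Derived K n) :
    Fin n → Derived K n :=
  Pi.single i (a • m) + Pi.single j (b • m)

section pairVec

variable {i j k N : Fin n} {a b : MvPolynomial (Fin n) K} {m m' : Derived K n}

theorem pairVec_left (hij : i ≠ j) : pairVec i j a b m i = a • m := by
  simp [pairVec, hij]

theorem pairVec_right (hij : i ≠ j) : pairVec i j a b m j = b • m := by
  simp [pairVec, hij.symm]

theorem pairVec_of_ne (hi : k ≠ i) (hj : k ≠ j) : pairVec i j a b m k = 0 := by
  simp [pairVec, hi, hj]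

theorem pairVec_add : pairVec i j a b (m + m') = pairVec i j a b m + pairVec i j a b m' := by
  simp only [pairVec, smul_add, Pi.single_add]
  abel

theorem pairVec_split (c : MvPolynomial (Fin n) K) :
    pairVec i j a b m = pairVec i k a (-c) m + pairVec k j c b m := by
  simp only [pairVec, neg_smul, Pi.single_neg]
  abel

theorem iaDerived_pairVec {μ : Fin n → Derived K n} (h : iaDerived μ m = m) (l : Fin n) :
    iaDerived μ (pairVec i j a b m l) = pairVec i j a b m l := by
  simp only [pairVec, Pi.add_apply, Pi.single_apply, map_add]
  split_ifs <;> simp [h]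

theorem almostTameIA_pairVec_brk {l : Fin n} (hki : k ≠ i) (hkj : k ≠ j) (hli : l ≠ i)
    (hlj : l ≠ j) (u : MvPolynomial (Fin n) K) :
    AlmostTameIA (pairVec i j a b (u • brk K k l)) := by
  rw [pairVec, smul_smul, smul_smul]
  refine (almostTameIA_single hki hli _).add (almostTameIA_single hkj hlj _) fun r => ?_
  simp only [Pi.single_apply _ _ r]
  split_ifs
  · simp [iaDerived_brk, hki, hli]
  · simp

theorem AlmostTameIA.add_smul_brk (h : AlmostTameIA (pairVec i j a b m)) (hki : k ≠ i)
    (hkj : k ≠ j) (hNi : N ≠ i) (hNj : N ≠ j) (u : MvPolynomial (Fin n) K) :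
    AlmostTameIA (pairVec i j a b (m + u • brk K k N)) := by
  rw [pairVec_add]
  refine h.add (almostTameIA_pairVec_brk hki hkj hNi hNj u) (iaDerived_pairVec ?_)
  simp [iaDerived_brk, pairVec_of_ne, *]

end pairVec

/-- The automorphism `A(h, g)` for the generators `xᵢ`, `xⱼ` and the last generator `x_N` is
almost tame for all `h`. -/
def TameAt (N i j : Fin n) (g : MvPolynomial (Fin n) K) : Prop :=
  ∀ h, AlmostTameIA (pairVec i j (h * g) (-h) (brk K i N + g • brk K j N))

theorem linear_comp (i j : Fin n) (hij : i ≠ j) (c c' : K) (hc : c + c' = 0)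
    (z : FreeMetabelianLie K n) :
    lift (Function.update (xg K n) i (xg K n i + c • xg K n j))
      (lift (Function.update (xg K n) i (xg K n i + c' • xg K n j)) z) = z := by
  have h : (lift (Function.update (xg K n) i (xg K n i + c • xg K n j))).comp
      (lift (Function.update (xg K n) i (xg K n i + c' • xg K n j))) = LieHom.id := by
    refine hom_ext fun k => ?_
    by_cases hk : k = i
    · subst hk
      simp [lift_xg, Function.update_of_ne hij.symm, add_assoc, ← add_smul, hc]
    · simp [lift_xg, Function.update_of_ne hk]
  exact LieHom.congr_fun h z

section

variable {i j k N : Fin n} {g : MvPolynomial (Fin n) K}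

theorem tameAt_C (hij : i ≠ j) (hi : i ≠ N) (hj : j ≠ N) (c : K) :
    TameAt N i j (C c : MvPolynomial (Fin n) K) := by
  intro h
  set m : Derived K n := brk K i N + (C c : MvPolynomial (Fin n) K) • brk K j N with hm
  set μ := pairVec i j (h * C c) (-h) m with hμ
  have hμi : μ i = (h * C c) • m := pairVec_left hij
  have hμj : μ j = (-h) • m := pairVec_right hij
  have hμN : μ N = 0 := pairVec_of_ne hi.symm hj.symm
  have h1 : iaDerived μ m = m := by
    conv_lhs => rw [hm]
    rw [map_add, map_smul, iaDerived_brk, iaDerived_brk, hμi, hμj, hμN, hm]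
    module
  have h2 : iaDerived (-μ) m = m := by
    conv_lhs => rw [hm]
    rw [map_add, map_smul, iaDerived_brk, iaDerived_brk, Pi.neg_apply, Pi.neg_apply,
      Pi.neg_apply, hμi, hμj, hμN, hm]
    module
  obtain ⟨e, he⟩ : ∃ e : FreeMetabelianLie K n ≃ₗ⁅K⁆ FreeMetabelianLie K n,
      ∀ z, e z = ia μ z :=
    exists_equiv_ia (iaDerived_pairVec h1) (iaDerived_pairVec h2)
  let L := equivOfInverse _ _ (linear_comp i j hij (-c) c (by simp))
    (linear_comp i j hij c (-c) (by simp))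
  have hL : ∀ k, k ≠ i → L (xg K n k) = xg K n k := fun k hk => by
    change lift _ _ = _
    rw [lift_xg, Function.update_of_ne hk]
  have hLi : L (xg K n i) = xg K n i + c • xg K n j := by
    change lift _ _ = _
    rw [lift_xg, Function.update_self]
  have hLt : L ∈ Subgroup.closure {ψ | IsCheinAut K n ψ} := Subgroup.subset_closure ⟨i, hL⟩
  have hE : L⁻¹ * e * L ∈ Subgroup.closure {ψ | IsCheinAut K n ψ} := by
    refine Subgroup.subset_closure ⟨j, fun k hk => ?_⟩
    change L.symm (e (L (xg K n k))) = _
    rw [← L.symm_apply_apply (xg K n k)]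
    congr 1
    rw [L.apply_symm_apply]
    by_cases hki : k = i
    · subst hki
      have h3 : (((h * C c) • m + c • ((-h) • m) : Derived K n) : FreeMetabelianLie K n) = 0 := by
        rw [← algebraMap_smul (MvPolynomial (Fin n) K) c, algebraMap_eq]
        have : (h * C c) • m + (C c : MvPolynomial (Fin n) K) • ((-h) • m) = 0 := by module
        rw [this]
        rfl
      rw [hLi, map_add, map_smul, he, he, ia_xg, ia_xg, hμi, hμj, smul_add c, add_add_add_comm]
      rw [LieSubmodule.coe_add, LieSubmodule.coe_smul] at h3
      rw [h3, add_zero]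
    · rw [hL k hki, he, ia_xg, hμ, pairVec_of_ne hki hk]
      simp
  refine ⟨e, ?_, he⟩
  have : e = L * (L⁻¹ * e * L) * L⁻¹ := by group
  rw [IsAlmostTame, this]
  exact Subgroup.mul_mem _ (Subgroup.mul_mem _ hLt hE) (Subgroup.inv_mem _ hLt)

theorem TameAt.move_left (h : TameAt N k j g) (hij : i ≠ j) (hik : i ≠ k) (hjk : j ≠ k)
    (hi : i ≠ N) (hj : j ≠ N) (hk : k ≠ N) : TameAt N i j g := by
  intro u
  have h1 := (tameAt_C (K := K) hik hi hk 1 (u * g)).add_smul_brk (N := N)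
    hij.symm hjk hi.symm hk.symm g
  have h2 := (h u).add_smul_brk (N := N) hik hij hk.symm hj.symm 1
  have e1 : brk K i N + (C 1 : MvPolynomial (Fin n) K) • brk K k N + g • brk K j N =
      brk K i N + g • brk K j N + brk K k N := by
    rw [C_1]
    module
  have e2 : brk K k N + g • brk K j N + (1 : MvPolynomial (Fin n) K) • brk K i N =
      brk K i N + g • brk K j N + brk K k N := by
    module
  rw [e1, C_1, mul_one] at h1
  rw [e2] at h2
  have h3 := h1.add h2 (iaDerived_pairVec (by
    simp only [map_add, map_smul, iaDerived_brk, pairVec_left hik, pairVec_right hik,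
      pairVec_of_ne hij.symm hjk, pairVec_of_ne hi.symm hk.symm]
    module))
  rw [← pairVec_split] at h3
  have h4 := h3.add_smul_brk (N := N) hik.symm hjk.symm hi.symm hj.symm (-1)
  convert h4 using 2
  module

theorem TameAt.move_right (h : TameAt N i k g) (hij : i ≠ j) (hik : i ≠ k) (hjk : j ≠ k)
    (hi : i ≠ N) (hj : j ≠ N) (hk : k ≠ N) : TameAt N i j g := by
  intro u
  have h1 := (h u).add_smul_brk (N := N) hij.symm hjk hi.symm hk.symm g
  have h2 : AlmostTameIA (pairVec k j u (-u) (g • brk K k N + g • brk K j N)) := by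
    convert tameAt_C (K := K) hjk.symm hk hj 1 (u * g) using 1
    simp only [pairVec, C_1]
    congr 2 <;> module
  replace h2 := h2.add_smul_brk (N := N) hik hij hk.symm hj.symm 1
  have e1 : brk K i N + g • brk K k N + g • brk K j N =
      brk K i N + g • brk K j N + g • brk K k N := by module
  have e2 : g • brk K k N + g • brk K j N + (1 : MvPolynomial (Fin n) K) • brk K i N =
      brk K i N + g • brk K j N + g • brk K k N := by module
  rw [e1] at h1
  rw [e2] at h2
  have h3 := h1.add h2 (iaDerived_pairVec (by
    simp only [map_add, map_smul, iaDerived_brk, pairVec_left hik, pairVec_right hik,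
      pairVec_of_ne hij.symm hjk, pairVec_of_ne hi.symm hk.symm]
    module))
  rw [← pairVec_split] at h3
  have h4 := h3.add_smul_brk (N := N) hik.symm hjk.symm hi.symm hj.symm (-g)
  convert h4 using 2
  module

theorem TameAt.add_mul_X_of_ne (h : TameAt N i j g) (hij : i ≠ j) (hi : i ≠ N) (hj : j ≠ N)
    (hki : k ≠ i) (hkj : k ≠ j) (p : MvPolynomial (Fin n) K) :
    TameAt N i j (g + p * X k) := by
  intro u
  have hJ := jacobi (K := K) j k N
  rw [← neg_brk j N] at hJ
  have h1 : AlmostTameIA (pairVec i j (u * (g + p * X k)) (-u)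
      (brk K i N + (g + p * X k) • brk K j N + -(p * X j) • brk K k N)) := by
    refine (almostTameIA_single hij.symm hki p).conj (h u) fun l => ?_
    by_cases hli : l = i
    · subst hli
      simp only [pairVec_left hij, Pi.single_eq_same, map_add, map_smul, iaDerived_brk,
        Pi.single_eq_of_ne hij.symm, Pi.single_eq_of_ne hi.symm, pairVec_right hij,
        pairVec_of_ne hki hkj]
      linear_combination (norm := module) (u * g * p) • hJ
    by_cases hlj : l = j
    · subst hlj
      simp only [pairVec_right hij, Pi.single_eq_same, map_add, map_smul, iaDerived_brk, map_zero,
        Pi.single_eq_of_ne hij.symm, Pi.single_eq_of_ne hi.symm]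
      linear_combination (norm := module) (-u * p) • hJ
    · simp [pairVec_of_ne hli hlj, hli]
  convert h1.add_smul_brk hki hkj hi.symm hj.symm (p * X j) using 2
  module

theorem tameAt_add_mul_X (h : ∀ i j, i ≠ j → i ≠ N → j ≠ N → TameAt N i j g) (hn : 4 ≤ n)
    (k : Fin n) (p : MvPolynomial (Fin n) K) (hij : i ≠ j) (hi : i ≠ N) (hj : j ≠ N) :
    TameAt N i j (g + p * X k) := by
  obtain ⟨l, hl⟩ : ∃ l, l ∉ ({i, j, N} : Finset (Fin n)) := by
    by_contra! hall
    have h1 := Finset.card_le_card (fun l _ => hall l : Finset.univ ⊆ ({i, j, N} : Finset (Fin n)))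
    have h2 := Finset.card_le_three (a := i) (b := j) (c := N)
    rw [Finset.card_univ, Fintype.card_fin] at h1
    omega
  simp only [Finset.mem_insert, Finset.mem_singleton, not_or] at hl
  obtain ⟨hli, hlj, hlN⟩ := hl
  by_cases hki : k = i
  · subst hki
    exact ((h l j hlj hlN hj).add_mul_X_of_ne hlj hlN hj (Ne.symm hli) hij p).move_left hij
      (Ne.symm hli) (Ne.symm hlj) hi hj hlN
  by_cases hkj : k = j
  · subst hkj
    exact ((h i l (Ne.symm hli) hi hlN).add_mul_X_of_ne (Ne.symm hli) hi hlN hki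
      (Ne.symm hlj) p).move_right hij (Ne.symm hli) (Ne.symm hlj) hi hj hlN
  exact (h i j hij hi hj).add_mul_X_of_ne hij hi hj hki hkj p

end

theorem tameAt (hn : 4 ≤ n) {N i j : Fin n} (hij : i ≠ j) (hi : i ≠ N) (hj : j ≠ N)
    (g : MvPolynomial (Fin n) K) : TameAt N i j g := by
  have key : ∀ p q : MvPolynomial (Fin n) K,
      (∀ i j, i ≠ j → i ≠ N → j ≠ N → TameAt N i j q) →
      ∀ i j, i ≠ j → i ≠ N → j ≠ N → TameAt N i j (q + (p - C (constantCoeff p))) := by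
    intro p
    induction p using MvPolynomial.induction_on with
    | C a => simp
    | add p₁ p₂ h₁ h₂ =>
      intro q hq
      have e : q + (p₁ + p₂ - C (constantCoeff (p₁ + p₂))) =
          q + (p₁ - C (constantCoeff p₁)) + (p₂ - C (constantCoeff p₂)) := by
        rw [map_add, map_add]
        ring
      rw [e]
      exact h₂ _ (h₁ q hq)
    | mul_X p k _ =>
      intro q hq i j hij hi hj
      convert tameAt_add_mul_X hq hn k p hij hi hj using 2
      simp
  have h := key g (C (constantCoeff g)) (fun i j hij hi hj => tameAt_C hij hi hj _) i j hij hi hj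
  rwa [add_sub_cancel] at h

end FreeMetabelianLie

end

/-- **Lemma 7.** Over any field `K`, for `n ≥ 4` and all `g, h ∈ U = K[y₁,…,yₙ]`, the
endomorphism `A(h,g) = (x₁ + [x₁,xₙ]hg + [x₂,xₙ]hg², x₂ - [x₁,xₙ]h - [x₂,xₙ]hg, x₃, …, xₙ)`
of `Mₙ` is an automorphism and is almost tame. -/
theorem A_h_g_is_almost_tame (K : Type) [Field K] (n : ℕ) (hn : 4 ≤ n)
    (g h : MvPolynomial (Fin n) K)
    (i0 i1 iN : Fin n) (h0 : (i0 : ℕ) = 0) (h1 : (i1 : ℕ) = 1) (hN : (iN : ℕ) = n - 1)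
    (φ : FreeMetabelianLie K n →ₗ⁅K⁆ FreeMetabelianLie K n)
    (hφ0 : φ (xg K n i0) = xg K n i0 + polyAct K n (h * g) ⁅xg K n i0, xg K n iN⁆
      + polyAct K n (h * g ^ 2) ⁅xg K n i1, xg K n iN⁆)
    (hφ1 : φ (xg K n i1) = xg K n i1 - polyAct K n h ⁅xg K n i0, xg K n iN⁆
      - polyAct K n (h * g) ⁅xg K n i1, xg K n iN⁆)
    (hφ : ∀ j : Fin n, j ≠ i0 → j ≠ i1 → φ (xg K n j) = xg K n j) :
    Function.Bijective φ ∧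
      ∃ e : FreeMetabelianLie K n ≃ₗ⁅K⁆ FreeMetabelianLie K n,
        (∀ m, e m = φ m) ∧ IsAlmostTame K n e := by
  have h01 : i0 ≠ i1 := fun h => by rw [h] at h0; omega
  have h0N : i0 ≠ iN := fun h => by rw [h] at h0; omega
  have h1N : i1 ≠ iN := fun h => by rw [h] at h1; omega
  obtain ⟨e, he, heφ⟩ := FreeMetabelianLie.tameAt hn h01 h0N h1N g h
  have hp : ∀ p i, polyAct K n p ⁅xg K n i, xg K n iN⁆ =
      ((p • FreeMetabelianLie.brk K i iN : FreeMetabelianLie.Derived K n) :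
        FreeMetabelianLie K n) :=
    fun p i => FreeMetabelianLie.polyAct_coe p (FreeMetabelianLie.brk K i iN)
  have hφe : ∀ m, e m = φ m := by
    intro m
    rw [heφ]
    refine LieHom.congr_fun (FreeMetabelianLie.hom_ext fun k => ?_) m
    rw [FreeMetabelianLie.ia_xg]
    by_cases hk0 : k = i0
    · subst hk0
      rw [FreeMetabelianLie.pairVec_left h01, hφ0, hp, hp, add_assoc, ← LieSubmodule.coe_add]
      congr 2
      module
    by_cases hk1 : k = i1
    · subst hk1
      rw [FreeMetabelianLie.pairVec_right h01, hφ1, hp, hp, sub_sub, ← LieSubmodule.coe_add,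
        sub_eq_add_neg, ← LieSubmodule.coe_neg]
      congr 2
      module
    rw [FreeMetabelianLie.pairVec_of_ne hk0 hk1, hφ k hk0 hk1]
    simp
  refine ⟨?_, e, hφe, he⟩
  rw [← funext hφe]
  exact e.bijective
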